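/- arXiv:math/0410615 — 5 statements merged into one kernel-verified Lean document; each statement's English description precedes it below -/
import Mathlib

section
/- Let π be a finitely generated group with normal subgroups A ≤ N such that A is free abelian of rank r, the index [π : N] is finite, and N is isomorphic (as a group) to the direct product A × (N/A). Then there exists a group homomorphism f from π to the isometry group E(r) of Euclidean r-space whose image is a discrete subgroup acting cocompactly on Euclidean r-space (i.e., the quotient of ℝ^r by the image is compact), and whose restriction to A is injective. -/
/-- `E r` is the isometry group of Euclidean `r`-space. -/
abbrev EuclideanIsometryGroup (r : ℕ) : Type :=
  EuclideanSpace ℝ (Fin r) ≃ᵢ EuclideanSpace ℝ (Fin r)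

/-- The natural topology on the isometry group of Euclidean `r`-space:
the topology of pointwise convergence, induced from the function space. -/
noncomputable instance (r : ℕ) : TopologicalSpace (EuclideanIsometryGroup r) :=
  TopologicalSpace.induced
    (fun g => (g : EuclideanSpace ℝ (Fin r) → EuclideanSpace ℝ (Fin r))) inferInstance

/-- The isometry group of Euclidean `r`-space acts on Euclidean `r`-space. -/
noncomputable instance (r : ℕ) : MulAction (EuclideanIsometryGroup r) (EuclideanSpace ℝ (Fin r)) where
  smul g x := g x
  one_smul _ := rfl
  mul_smul _ _ _ := rfl

/-- Precomposition with a group homomorphism, as a linear map between groups of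
integer-valued homomorphisms. -/
def intHomComp {G H : Type*} [Group G] [Group H] (f : G →* H) :
    (Additive H →+ ℤ) →ₗ[ℤ] (Additive G →+ ℤ) where
  toFun ψ := ψ.comp (MonoidHom.toAdditive f)
  map_add' _ _ := rfl
  map_smul' _ _ := rfl

theorem intHomComp_apply {G H : Type*} [Group G] [Group H] (f : G →* H)
    (ψ : Additive H →+ ℤ) (g : G) :
    intHomComp f ψ (Additive.ofMul g) = ψ (Additive.ofMul (f g)) := rfl

theorem intHom_finite (G : Type*) [Group G] [Group.FG G] :
    Module.Finite ℤ (Additive G →+ ℤ) := by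
  obtain ⟨S, hS⟩ := Group.FG.out (G := G)
  let ev : (Additive G →+ ℤ) →ₗ[ℤ] (S → ℤ) :=
    { toFun := fun ψ s => ψ (Additive.ofMul (s : G))
      map_add' := fun _ _ => rfl
      map_smul' := fun _ _ => rfl }
  refine Module.Finite.of_injective ev fun ψ₁ ψ₂ h => ?_
  have : AddMonoidHom.toMultiplicativeRight ψ₁ = AddMonoidHom.toMultiplicativeRight ψ₂ :=
    MonoidHom.eq_of_eqOn_dense hS fun s hs => congrFun h ⟨s, hs⟩
  exact AddMonoidHom.toMultiplicativeRight.injective this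

theorem intHom_free (G : Type*) [Group G] [Group.FG G] :
    Module.Free ℤ (Additive G →+ ℤ) := by
  have := intHom_finite G
  have : Module.IsTorsionFree ℤ (Additive G →+ ℤ) :=
    Function.Injective.moduleIsTorsionFree (fun ψ : Additive G →+ ℤ => (ψ : Additive G → ℤ))
      DFunLike.coe_injective fun _ _ => rfl
  exact Module.free_of_finite_type_torsion_free'

/-- Integer-valued homomorphisms out of a product. -/
noncomputable def intHomProdEquiv (G H : Type*) [Group G] [Group H] :
    (Additive (G × H) →+ ℤ) ≃ₗ[ℤ] (Additive G →+ ℤ) × (Additive H →+ ℤ) :=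
  LinearEquiv.ofBijective
    ((intHomComp (MonoidHom.inl G H)).prod (intHomComp (MonoidHom.inr G H))) <| by
    constructor
    · intro ψ₁ ψ₂ h
      refine AddMonoidHom.ext fun x => ?_
      obtain ⟨a, b⟩ := x
      have key : ∀ ψ : Additive (G × H) →+ ℤ, ψ (Additive.ofMul (a, b)) =
          ψ (Additive.ofMul (a, 1)) + ψ (Additive.ofMul (1, b)) := fun ψ => by
        rw [← map_add, ← ofMul_mul]; simp
      have h1 : ψ₁ (Additive.ofMul (a, 1)) = ψ₂ (Additive.ofMul (a, 1)) :=
        DFunLike.congr_fun (congrArg Prod.fst h) (Additive.ofMul a)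
      have h2 : ψ₁ (Additive.ofMul (1, b)) = ψ₂ (Additive.ofMul (1, b)) :=
        DFunLike.congr_fun (congrArg Prod.snd h) (Additive.ofMul b)
      change ψ₁ (Additive.ofMul (a, b)) = ψ₂ (Additive.ofMul (a, b))
      rw [key, key, h1, h2]
    · rintro ⟨α, β⟩
      refine ⟨intHomComp (MonoidHom.fst G H) α + intHomComp (MonoidHom.snd G H) β, ?_⟩
      refine Prod.ext (AddMonoidHom.ext fun x => ?_) (AddMonoidHom.ext fun x => ?_)
      · change α x + β 0 = α x
        simp
      · change α 0 + β x = β x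
        simp

/-- If a finitely generated group `G` is abstractly isomorphic to `K × G ⧸ K`, then a nonzero
multiple of any homomorphism `K → ℤ` extends to `G`. -/
theorem exists_smul_intHom_extends {G : Type*} [Group G] [Group.FG G] (K : Subgroup G) [K.Normal]
    (e : G ≃* K × (G ⧸ K)) (ψ : Additive K →+ ℤ) :
    ∃ d : ℤ, d ≠ 0 ∧ ∃ Ψ : Additive G →+ ℤ, intHomComp K.subtype Ψ = d • ψ := by
  have : Group.FG K := Group.fg_of_surjective (f := (MonoidHom.fst K (G ⧸ K)).comp e.toMonoidHom)
    (Prod.fst_surjective.comp e.surjective)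
  have := intHom_finite G
  have := intHom_finite K
  have := intHom_finite (G ⧸ K)
  have := intHom_free K
  have := intHom_free (G ⧸ K)
  let res := intHomComp K.subtype
  have hprod : Module.finrank ℤ (Additive G →+ ℤ) =
      Module.finrank ℤ (Additive K →+ ℤ) + Module.finrank ℤ (Additive (G ⧸ K) →+ ℤ) := by
    rw [← Module.finrank_prod, ← (intHomProdEquiv K (G ⧸ K)).finrank_eq]
    refine (LinearEquiv.ofBijective (intHomComp e.toMonoidHom) ⟨fun ψ₁ ψ₂ h => ?_, fun ψ => ?_⟩
      ).symm.finrank_eq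
    · refine AddMonoidHom.ext fun x => ?_
      have := DFunLike.congr_fun h (Additive.ofMul (e.symm x.toMul))
      simpa [intHomComp_apply] using! this
    · refine ⟨intHomComp e.symm.toMonoidHom ψ, AddMonoidHom.ext fun x => ?_⟩
      change ψ (Additive.ofMul (e.symm (e x.toMul))) = ψ x
      simp
  have hker : Module.finrank ℤ res.ker ≤ Module.finrank ℤ (Additive (G ⧸ K) →+ ℤ) := by
    have hle : res.ker ≤ (intHomComp (QuotientGroup.mk' K)).range := by
      intro Ψ hΨ
      refine ⟨MonoidHom.toAdditiveLeft (QuotientGroup.lift K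
        (AddMonoidHom.toMultiplicativeRight Ψ) fun k hk => ?_), ?_⟩
      · exact DFunLike.congr_fun hΨ (Additive.ofMul (⟨k, hk⟩ : K))
      · ext x
        rfl
    exact (Submodule.finrank_mono hle).trans (LinearMap.finrank_range_le _)
  have h1 := Submodule.finrank_quotient_add_finrank res.ker
  rw [res.quotKerEquivRange.finrank_eq] at h1
  have h2 := Submodule.finrank_quotient_add_finrank res.range
  have h0 : Module.finrank ℤ ((Additive K →+ ℤ) ⧸ res.range) = 0 := by omega
  obtain ⟨d, hd, h⟩ := Module.finrank_eq_zero_iff.1 h0 (Submodule.Quotient.mk ψ)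
  rw [← Submodule.Quotient.mk_smul, Submodule.Quotient.mk_eq_zero] at h
  exact ⟨d, hd, h⟩

/-- Vector-valued version of `exists_smul_intHom_extends`. -/
theorem exists_smul_intVecHom_extends {G : Type*} [Group G] [Group.FG G] (K : Subgroup G)
    [K.Normal] (e : G ≃* K × (G ⧸ K)) {ι : Type*} [Fintype ι] (ψ : Additive K →+ (ι → ℤ)) :
    ∃ d : ℤ, d ≠ 0 ∧ ∃ Ψ : Additive G →+ (ι → ℤ),
      ∀ k : K, Ψ (Additive.ofMul (k : G)) = d • ψ (Additive.ofMul k) := by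
  choose d hd Ψ hΨ using fun i =>
    exists_smul_intHom_extends K e ((Pi.evalAddMonoidHom (fun _ : ι => ℤ) i).comp ψ)
  choose q hq using fun i => Finset.dvd_prod_of_mem d (Finset.mem_univ i)
  refine ⟨∏ i, d i, Finset.prod_ne_zero_iff.2 fun i _ => hd i,
    AddMonoidHom.mk' (fun x i => q i * Ψ i x) fun x y => ?_, fun k => ?_⟩
  · ext i
    simp [mul_add]
  · ext i
    have : Ψ i (Additive.ofMul (k : G)) = d i * ψ (Additive.ofMul k) i :=
      DFunLike.congr_fun (hΨ i) (Additive.ofMul k)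
    simp only [AddMonoidHom.mk'_apply, this, Pi.smul_apply, smul_eq_mul]
    rw [hq i]
    ring

/-- Transfer of a homomorphism from a normal subgroup `N` of finite index to a crossed
homomorphism on the whole group. -/
theorem exists_crossedHom_transfer {G V : Type*} [Group G] [AddCommGroup V] (N : Subgroup G)
    [N.Normal] [Fintype (G ⧸ N)] (ρ : G →* Module.End ℤ V) (hρ : ∀ n ∈ N, ρ n = 1)
    (φ : G → V) (hφ : ∀ m ∈ N, ∀ n ∈ N, φ (m * n) = φ m + φ n) :
    ∃ c : G → V, (∀ g h, c (g * h) = c g + ρ g (c h)) ∧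
      ∀ n ∈ N, c n = ∑ x : G ⧸ N, ρ x.out (φ (x.out⁻¹ * n * x.out)) := by
  have hmem : ∀ (g : G) (x : G ⧸ N), (g • x).out⁻¹ * (g * x.out) ∈ N := fun g x => by
    rw [← QuotientGroup.eq]
    simp [← MulAction.Quotient.coe_smul_out]
  refine ⟨fun g => ∑ x : G ⧸ N, ρ (g • x).out (φ ((g • x).out⁻¹ * (g * x.out))), fun g h => ?_,
    fun n hn => ?_⟩
  · have h1 : ∀ x : G ⧸ N, ρ ((g * h) • x).out (φ (((g * h) • x).out⁻¹ * (g * h * x.out))) =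
        ρ (g • h • x).out (φ ((g • h • x).out⁻¹ * (g * (h • x).out))) +
          ρ g (ρ (h • x).out (φ ((h • x).out⁻¹ * (h * x.out)))) := fun x => by
      have h2 : ρ (g * (h • x).out) = ρ (g • h • x).out := by
        have := hρ _ (hmem g (h • x))
        rw [← mul_one (ρ (g • h • x).out), ← this, ← map_mul, mul_inv_cancel_left]
      have h3 : ((g * h) • x).out⁻¹ * (g * h * x.out) =
          ((g • h • x).out⁻¹ * (g * (h • x).out)) * ((h • x).out⁻¹ * (h * x.out)) := by
        rw [mul_smul]; group
      rw [h3, hφ _ (hmem _ _) _ (hmem _ _), map_add, ← Module.End.mul_apply (ρ g), ← map_mul, h2,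
        mul_smul]
    simp only [h1, Finset.sum_add_distrib, map_sum]
    congr 1
    exact Fintype.sum_equiv (MulAction.toPerm h) _
      (fun x : G ⧸ N => ρ (g • x).out (φ ((g • x).out⁻¹ * (g * x.out)))) fun _ => rfl
  · refine Finset.sum_congr rfl fun x _ => ?_
    have : n • x = x := by
      induction x using QuotientGroup.induction_on with
      | H y =>
        rw [MulAction.Quotient.smul_coe, smul_eq_mul]
        refine (QuotientGroup.eq.2 ?_).symm
        simpa [mul_assoc] using (inferInstance : N.Normal).conj_mem n hn y⁻¹
    simp only [this, mul_assoc]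

/-- A real representation of a finite group is orthogonal in suitable coordinates. -/
theorem exists_linearEquiv_norm_invariant {Q V : Type*} [Group Q] [Finite Q] [AddCommGroup V]
    [Module ℝ V] {r : ℕ} (b : Module.Basis (Fin r) ℝ V) (ρ : Q →* Module.End ℝ V) :
    ∃ B : V ≃ₗ[ℝ] EuclideanSpace ℝ (Fin r), ∀ q v, ‖B (ρ q v)‖ = ‖B v‖ := by
  have := Fintype.ofFinite Q
  let E := b.equivFun.trans (WithLp.linearEquiv 2 ℝ (Fin r → ℝ)).symm
  let J : V →ₗ[ℝ] PiLp 2 (fun _ : Q => EuclideanSpace ℝ (Fin r)) :=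
    (WithLp.linearEquiv 2 ℝ (Q → EuclideanSpace ℝ (Fin r))).symm.toLinearMap ∘ₗ
      LinearMap.pi fun q => E.toLinearMap ∘ₗ ρ q
  have hJ : ∀ v q, J v q = E (ρ q v) := fun _ _ => rfl
  have hinj : Function.Injective J := fun v w h => by
    have := congrArg (fun z => z 1) h
    simpa [hJ] using this
  have hfin : Module.finrank ℝ J.range = r := by
    rw [LinearMap.finrank_range_of_inj hinj, Module.finrank_eq_card_basis b, Fintype.card_fin]
  let T := ((stdOrthonormalBasis ℝ J.range).reindex (finCongr hfin)).repr
  refine ⟨(LinearEquiv.ofInjective J hinj).trans T.toLinearEquiv, fun q v => ?_⟩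
  have hB : ∀ v, ‖((LinearEquiv.ofInjective J hinj).trans T.toLinearEquiv) v‖ = ‖J v‖ :=
    fun v => T.norm_map _
  rw [hB, hB, PiLp.norm_eq_of_L2, PiLp.norm_eq_of_L2]
  congr 1
  refine Fintype.sum_equiv (Equiv.mulRight q) _ _ fun p => ?_
  simp [hJ]

/-- Extension of scalars from `ℤ` to `ℝ` for representations on `ℤ^r`. -/
noncomputable def realEnd (r : ℕ) : Module.End ℤ (Fin r → ℤ) →* Module.End ℝ (Fin r → ℝ) :=
  ((Matrix.toLinAlgEquiv' (R := ℝ) (n := Fin r)).toMulEquiv.toMonoidHom.comp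
    ((Int.castRingHom ℝ).mapMatrix : Matrix (Fin r) (Fin r) ℤ →+* _).toMonoidHom).comp
    (LinearMap.toMatrixAlgEquiv' (R := ℤ) (n := Fin r)).toMulEquiv.toMonoidHom

theorem realEnd_intCast {r : ℕ} (T : Module.End ℤ (Fin r → ℤ)) (v : Fin r → ℤ) :
    realEnd r T (fun i => (v i : ℝ)) = fun i => ((T v i : ℤ) : ℝ) := by
  have h : T v = (LinearMap.toMatrixAlgEquiv' T).mulVec v := by
    rw [← Matrix.toLinAlgEquiv'_apply, Matrix.toLinAlgEquiv'_toMatrixAlgEquiv']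
  ext i
  rw [h]
  simp [realEnd, Matrix.mulVec, dotProduct]

/-- An integral representation with finite image together with an integral crossed homomorphism
whose values contain a lattice defines a crystallographic action. -/
theorem exists_crystallographic_action {G : Type*} [Group G] {r : ℕ} (N : Subgroup G) [N.Normal]
    [N.FiniteIndex] (ρ : G →* Module.End ℤ (Fin r → ℤ)) (hρ : ∀ n ∈ N, ρ n = 1)
    (c : G → Fin r → ℤ) (hc : ∀ g h, c (g * h) = c g + ρ g (c h))
    (k : ℤ) (hk : k ≠ 0) (hlat : ∀ v, ∃ n ∈ N, c n = k • v) :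
    ∃ f : G →* EuclideanIsometryGroup r,
      DiscreteTopology f.range ∧
      CompactSpace (Quotient (MulAction.orbitRel f.range (EuclideanSpace ℝ (Fin r)))) ∧
      ∀ g, f g = 1 → c g = 0 := by
  let ι : (Fin r → ℤ) →+ (Fin r → ℝ) := (Int.castAddHom ℝ).compLeft (Fin r)
  have hι : Function.Injective ι := fun v w h => funext fun i => Int.cast_injective (congrFun h i)
  let σ : G →* Module.End ℝ (Fin r → ℝ) := (realEnd r).comp ρ
  have hσ : ∀ g v, σ g (ι v) = ι (ρ g v) := fun g v => realEnd_intCast (ρ g) v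
  have hσN : ∀ n ∈ N, σ n = 1 := fun n hn => by simp [σ, hρ n hn]
  obtain ⟨B, hB⟩ := exists_linearEquiv_norm_invariant (Pi.basisFun ℝ (Fin r))
    (QuotientGroup.lift N σ hσN)
  replace hB : ∀ g v, ‖B (σ g v)‖ = ‖B v‖ := fun g v => hB (g : G ⧸ N) v
  have hc1 : c 1 = 0 := by simpa using hc 1 1
  let F : G → EuclideanSpace ℝ (Fin r) → EuclideanSpace ℝ (Fin r) :=
    fun g x => B (σ g (B.symm x) + ι (c g))
  have hF1 : ∀ x, F 1 x = x := fun x => by simp [F, hc1]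
  have hFmul : ∀ g h x, F (g * h) x = F g (F h x) := fun g h x => by
    simp [F, hc, hσ, add_assoc, add_comm]
  have hFiso : ∀ g, Isometry (F g) := fun g => Isometry.of_dist_eq fun x y => by
    rw [dist_eq_norm, dist_eq_norm, ← map_sub, add_sub_add_right_eq_sub, ← map_sub, hB, map_sub]
    simp
  let f : G →* EuclideanIsometryGroup r := MonoidHom.mk'
    (fun g => IsometryEquiv.mk' (F g) (F g⁻¹) (fun x => by rw [← hFmul, mul_inv_cancel, hF1])
      (hFiso g)) fun g h => IsometryEquiv.ext fun x => hFmul g h x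
  have hf : ∀ g x, f g x = F g x := fun _ _ => rfl
  have hfι : ∀ g v, f g (B (ι v)) = B (ι (ρ g v + c g)) := fun g v => by
    simp [hf, F, hσ]
  refine ⟨f, ?_, ?_, fun g hg => ?_⟩
  · have hcont : ∀ x : EuclideanSpace ℝ (Fin r), Continuous fun u : f.range =>
        B.symm ((u : EuclideanIsometryGroup r) x) := fun x =>
      (LinearMap.continuous_of_finiteDimensional B.symm.toLinearMap).comp
        ((continuous_apply x).comp (continuous_induced_dom.comp continuous_subtype_val))
    refine discreteTopology_iff_isOpen_singleton.2 fun u => ?_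
    let p : Option (Fin r) → Fin r → ℤ := fun j => j.elim 0 fun i => Pi.single i 1
    convert isOpen_iInter_of_finite fun j : Option (Fin r) =>
      (Metric.isOpen_ball (x := B.symm ((u : EuclideanIsometryGroup r) (B (ι (p j))))) (ε := 1)
        ).preimage (hcont (B (ι (p j)))) using 1
    ext w
    simp only [Set.mem_singleton_iff, Set.mem_iInter, Set.mem_preimage]
    refine ⟨fun h j => h ▸ Metric.mem_ball_self one_pos, fun h => ?_⟩
    obtain ⟨_, g, rfl⟩ := u
    obtain ⟨_, g', rfl⟩ := w
    have heq : ∀ j, ρ g' (p j) + c g' = ρ g (p j) + c g := fun j => by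
      have hj := h j
      simp only [hfι, LinearEquiv.symm_apply_apply, Metric.mem_ball] at hj
      ext i
      have hi := (dist_le_pi_dist _ _ i).trans_lt hj
      rw [Real.dist_eq] at hi
      simp only [ι, AddMonoidHom.compLeft_apply, Function.comp_apply, Int.coe_castAddHom] at hi
      rw [← Int.cast_sub, ← Int.cast_abs] at hi
      have : |(ρ g' (p j) + c g') i - (ρ g (p j) + c g) i| < 1 := by exact_mod_cast hi
      exact sub_eq_zero.1 (Int.abs_lt_one_iff.1 this)
    have hcc : c g' = c g := by simpa [p] using heq none
    have hρρ : ρ g' = ρ g := (Pi.basisFun ℤ (Fin r)).ext fun i => by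
      simpa [p, hcc] using heq (some i)
    refine Subtype.ext (IsometryEquiv.ext fun x => ?_)
    change F g' x = F g x
    simp only [F, σ, MonoidHom.comp_apply, hcc, hρρ]
  · let K : Set (EuclideanSpace ℝ (Fin r)) := (fun x => B ((k : ℝ) • x)) '' Set.Icc 0 1
    have hK : IsCompact K := isCompact_Icc.image
      ((LinearMap.continuous_of_finiteDimensional B.toLinearMap).comp (continuous_const_smul _))
    have hcov : Quotient.mk (MulAction.orbitRel f.range (EuclideanSpace ℝ (Fin r))) '' K =
        Set.univ := by
      refine Set.eq_univ_of_forall fun q => ?_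
      induction q using Quotient.inductionOn with
      | h x =>
        let y := (k : ℝ)⁻¹ • B.symm x
        obtain ⟨n, hn, hcn⟩ := hlat fun i => ⌊y i⌋
        refine ⟨_, ⟨fun i => Int.fract (y i), ⟨fun i => Int.fract_nonneg _,
          fun i => (Int.fract_lt_one _).le⟩, rfl⟩, ?_⟩
        refine Quotient.sound ((MulAction.orbitRel f.range _).symm
          ⟨⟨f n, n, rfl⟩, ?_⟩)
        change F n _ = x
        have hk' : (k : ℝ) ≠ 0 := Int.cast_ne_zero.2 hk
        have : B.symm x = (k : ℝ) • y := by simp [y, hk']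
        rw [← B.apply_symm_apply x, this]
        simp only [F, hσN n hn, hcn, LinearEquiv.symm_apply_apply]
        congr 1
        ext i
        simp [ι, ← mul_add, Int.fract_add_floor]
    exact ⟨hcov ▸ hK.image continuous_quotient_mk'⟩
  · have := hfι g 0
    rw [hg] at this
    exact (hι (B.injective (by simpa using! this))).symm

theorem lemma1 {π : Type*} [Group π] [Group.FG π] (r : ℕ)
    (A N : Subgroup π) [A.Normal] [N.Normal] (hAN : A ≤ N)
    (hA : Nonempty (A ≃* Multiplicative (Fin r → ℤ)))
    (hNindex : N.FiniteIndex)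
    (hsplit : Nonempty (N ≃* (A.subgroupOf N) × (N ⧸ A.subgroupOf N))) :
    ∃ f : π →* EuclideanIsometryGroup r,
      DiscreteTopology f.range ∧
      CompactSpace (Quotient (MulAction.orbitRel f.range (EuclideanSpace ℝ (Fin r)))) ∧
      Function.Injective (f.comp A.subtype) := by
  obtain ⟨e⟩ := hA
  obtain ⟨s⟩ := hsplit
  let E : Additive A ≃+ (Fin r → ℤ) := MulEquiv.toAdditiveLeft e
  let incl : Additive (A.subgroupOf N) →+ Additive A :=
    MonoidHom.toAdditive (Subgroup.subgroupOfEquivOfLe hAN).toMonoidHom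
  obtain ⟨d, hd, Ψ, hΨ⟩ := exists_smul_intVecHom_extends (A.subgroupOf N) s
    (E.toAddMonoidHom.comp incl)
  replace hΨ : ∀ a : A, Ψ (Additive.ofMul ⟨a, hAN a.2⟩) = d • E (Additive.ofMul a) := fun a =>
    hΨ ⟨⟨a, hAN a.2⟩, a.2⟩
  let ρ : π →* Module.End ℤ (Fin r → ℤ) :=
    { toFun := fun g => (E.toAddMonoidHom.comp ((MonoidHom.toAdditive
        (MulAut.conjNormal (H := A) g).toMonoidHom).comp
          E.symm.toAddMonoidHom)).toIntLinearMap
      map_one' := LinearMap.ext fun v => by simp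
      map_mul' := fun g h => LinearMap.ext fun v => by simp }
  have hρE : ∀ g (a : A), ρ g (E (Additive.ofMul a)) =
      E (Additive.ofMul (MulAut.conjNormal g a)) := fun g a => by simp [ρ]
  have hρN : ∀ n ∈ N, ρ n = 1 := fun n hn => LinearMap.ext fun v => by
    obtain ⟨a, rfl⟩ := E.surjective v
    refine smul_right_injective _ hd ?_
    change d • ρ n (E (Additive.ofMul a.toMul)) = d • E (Additive.ofMul a.toMul)
    rw [hρE, ← hΨ, ← hΨ]
    have : (⟨(MulAut.conjNormal n a.toMul : A), hAN (MulAut.conjNormal n a.toMul).2⟩ : N) =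
        ⟨n, hn⟩ * ⟨a.toMul, hAN a.toMul.2⟩ * ⟨n, hn⟩⁻¹ := Subtype.ext (by simp)
    rw [this, ofMul_mul, ofMul_mul, ofMul_inv, map_add, map_add, map_neg]
    abel
  classical
  let φ : π → Fin r → ℤ := fun g => if hg : g ∈ N then Ψ (Additive.ofMul ⟨g, hg⟩) else 0
  have := Fintype.ofFinite (π ⧸ N)
  obtain ⟨c, hc, hcN⟩ := exists_crossedHom_transfer N ρ hρN φ fun m hm n hn => by
    simp only [φ, hm, hn, N.mul_mem hm hn, dif_pos, ← map_add, ← ofMul_mul]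
    rfl
  have hcA : ∀ a : A, c a = (Fintype.card (π ⧸ N) * d) • E (Additive.ofMul a) := fun a => by
    have hterm : ∀ x : π ⧸ N, ρ x.out (φ (x.out⁻¹ * a * x.out)) = d • E (Additive.ofMul a) :=
      fun x => by
        have h1 : x.out⁻¹ * a * x.out = (MulAut.conjNormal x.out⁻¹ a : A) := by simp
        have h2 : φ (MulAut.conjNormal x.out⁻¹ a : A) =
            d • E (Additive.ofMul (MulAut.conjNormal x.out⁻¹ a)) := by
          rw [← hΨ]
          exact dif_pos _
        rw [h1, h2, map_smul, hρE, ← MulAut.mul_apply, ← map_mul, mul_inv_cancel, map_one,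
          MulAut.one_apply]
    rw [hcN a (hAN a.2), Finset.sum_congr rfl fun x _ => hterm x, Finset.sum_const,
      Finset.card_univ, mul_smul, natCast_zsmul]
  have hk : (Fintype.card (π ⧸ N) * d : ℤ) ≠ 0 :=
    mul_ne_zero (Nat.cast_ne_zero.2 Fintype.card_ne_zero) hd
  obtain ⟨f, hdisc, hcomp, hker⟩ := exists_crystallographic_action N ρ hρN c hc _ hk fun v =>
    ⟨(E.symm v).toMul, hAN (E.symm v).toMul.2, by rw [hcA]; simp⟩
  refine ⟨f, hdisc, hcomp, (injective_iff_map_eq_one _).2 fun a ha => ?_⟩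
  have h0 := hker a ha
  rw [hcA, smul_eq_zero_iff_right hk] at h0
  exact E.map_eq_zero_iff.1 h0
end

section
/- Let π be a finitely generated group with normal subgroups A ≤ N such that A is free abelian of rank r, the index [π : N] is finite, and N is isomorphic (as a group) to the direct product A × (N/A). Then there exist a group H and a surjective group homomorphism q : π → H such that the restriction of q to A is injective and the image q(A) is a subgroup of finite index in H. -/
/-- A linear map `i : V → M` out of a free module is injective as soon as `M` surjects
onto `V × P` and `P` surjects onto the cokernel of `i`. -/
theorem LinearMap.injective_of_surjective_prod {R V M P : Type*} [CommRing R] [IsDomain R]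
    [AddCommGroup V] [Module R V] [Module.Finite R V] [Module.Free R V]
    [IsNoetherianRing R] [AddCommGroup M] [Module R M] [Module.Finite R M]
    [AddCommGroup P] [Module R P] [Module.Finite R P]
    (i : V →ₗ[R] M) (s : M →ₗ[R] V × P) (hs : Function.Surjective s)
    (p : P →ₗ[R] M ⧸ LinearMap.range i) (hp : Function.Surjective p) :
    Function.Injective i := by
  have ker_eq := Submodule.finrank_quotient_add_finrank (LinearMap.ker i)
  have range_eq := Submodule.finrank_quotient_add_finrank (LinearMap.range i)
  have le_prod : Module.finrank R V + Module.finrank R P ≤ Module.finrank R M := by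
    have rank_add := Submodule.finrank_quotient_add_finrank
      (LinearMap.ker (LinearMap.snd R V P))
    have equiv_ker := (LinearEquiv.ofInjective (LinearMap.inl R V P)
      LinearMap.inl_injective).finrank_eq
    rw [LinearMap.range_inl] at equiv_ker
    have equiv_quot := ((LinearMap.snd R V P).quotKerEquivOfSurjective
      LinearMap.snd_surjective).finrank_eq
    have := LinearMap.finrank_le_finrank_of_surjective hs
    omega
  have le_quot := LinearMap.finrank_le_finrank_of_surjective hp
  have equiv_range := i.quotKerEquivRange.finrank_eq
  rw [← LinearMap.ker_eq_bot, ← Submodule.finrank_eq_zero (R := R)]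
  omega

/-- A free subgroup of finite rank of a finitely generated abelian group is, up to a nonzero
multiple, a direct factor. -/
theorem exists_linearMap_comp_eq_smul {ι M : Type*} [Finite ι] [AddCommGroup M]
    [Module.Finite ℤ M] (i : (ι → ℤ) →ₗ[ℤ] M) (hi : Function.Injective i) :
    ∃ (d : ℤ) (f : M →ₗ[ℤ] (ι → ℤ)), d ≠ 0 ∧ ∀ v, f (i v) = d • v := by
  classical
  have := Fintype.ofFinite ι
  choose h hh using fun j : ι ↦ (Module.Baer.of_divisible ℚ).extension_property i hi
    ((Int.castAddHom ℚ).toIntLinearMap ∘ₗ LinearMap.proj j)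
  obtain ⟨S, hS⟩ := Module.Finite.fg_top (R := ℤ) (M := M)
  obtain ⟨b, hb⟩ := IsLocalization.exist_integer_multiples (nonZeroDivisors ℤ)
    (S ×ˢ Finset.univ) (fun x : M × ι ↦ h x.2 x.1)
  have integral (j : ι) (m : M) : ∃ z : ℤ, (z : ℚ) = (b : ℤ) • h j m := by
    have hm : m ∈ Submodule.span ℤ (S : Set M) := hS ▸ Submodule.mem_top
    induction hm using Submodule.span_induction with
    | mem x hx => exact hb (x, j) (by simpa using hx)
    | zero => exact ⟨0, by simp⟩
    | add x y _ _ hx hy =>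
      obtain ⟨u, hu⟩ := hx
      obtain ⟨v, hv⟩ := hy
      exact ⟨u + v, by rw [map_add, smul_add, ← hu, ← hv]; push_cast; rfl⟩
    | smul a x _ hx =>
      obtain ⟨u, hu⟩ := hx
      exact ⟨a * u, by rw [map_smul, smul_comm, ← hu]; simp⟩
  choose g hg using integral
  refine ⟨b, LinearMap.pi fun j ↦ (AddMonoidHom.mk' (g j) fun x y ↦ ?_).toIntLinearMap,
    nonZeroDivisors.coe_ne_zero b, fun v ↦ ?_⟩
  · have : (g j (x + y) : ℚ) = (g j x + g j y : ℤ) := by push_cast; simp [hg]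
    exact_mod_cast this
  · ext j
    have key : (g j (i v) : ℚ) = ((b : ℤ) * v j : ℤ) := by
      rw [hg, show h j (i v) = v j from congr($(hh j) v)]
      simp
    exact_mod_cast key

theorem Group.FG.countable (G : Type*) [Group G] [Group.FG G] : Countable G := by
  obtain ⟨α, _, φ, hφ⟩ := Group.fg_iff_exists_freeGroup_hom_surjective_finite.mp ‹Group.FG G›
  have : Countable (FreeGroup α) := Quot.mk_surjective.countable
  exact hφ.countable

theorem Abelianization.finite_additive (G : Type*) [Group G] [Group.FG G] :
    Module.Finite ℤ (Additive (Abelianization G)) := by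
  have : Group.FG (Abelianization G) := QuotientGroup.fg _
  exact Module.Finite.iff_addGroup_fg.mpr inferInstance

/-- If `G` is abstractly isomorphic to `B × G ⧸ B` with `B` free abelian of finite rank, then
`B` is virtually a retract of `G`, and embeds into the abelianization of `G`. -/
theorem exists_monoidHom_eq_zpow_of_mulEquiv_prod {G ι : Type*} [Group G] [Group.FG G] [Finite ι]
    (B : Subgroup G) [B.Normal] (e : B ≃* Multiplicative (ι → ℤ)) (s : G ≃* B × (G ⧸ B)) :
    Function.Injective (Abelianization.of.comp B.subtype) ∧
      ∃ (f : G →* B) (d : ℤ), d ≠ 0 ∧ ∀ b : B, f b = b ^ d := by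
  have := Abelianization.finite_additive G
  have : Group.FG (G ⧸ B) := QuotientGroup.fg _
  have := Abelianization.finite_additive (G ⧸ B)
  let incl : B →* Abelianization G := Abelianization.of.comp B.subtype
  let i : (ι → ℤ) →ₗ[ℤ] Additive (Abelianization G) :=
    (MonoidHom.toAdditiveRight (incl.comp e.symm.toMonoidHom)).toIntLinearMap
  have hi_apply (b : B) : i (e b).toAdd = Additive.ofMul (Abelianization.of (b : G)) := by
    simp [i, incl]
  let toProd : G →* Multiplicative ((ι → ℤ) × Additive (Abelianization (G ⧸ B))) :=
    { toFun := fun g ↦ .ofAdd ((e (s g).1).toAdd, .ofMul (Abelianization.of (s g).2))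
      map_one' := by simp
      map_mul' := fun x y ↦ by simp; rfl }
  let sM : Additive (Abelianization G) →ₗ[ℤ] (ι → ℤ) × Additive (Abelianization (G ⧸ B)) :=
    (MonoidHom.toAdditiveLeft (Abelianization.lift toProd)).toIntLinearMap
  have hsM : Function.Surjective sM := by
    rintro ⟨v, c⟩
    obtain ⟨c, rfl⟩ := Additive.ofMul.surjective c
    obtain ⟨c, rfl⟩ := QuotientGroup.mk_surjective c
    refine ⟨.ofMul (Abelianization.of (s.symm (e.symm (.ofAdd v), c))), ?_⟩
    simp [sM, toProd]
    rfl
  let toCoker : G →* Multiplicative (Additive (Abelianization G) ⧸ LinearMap.range i) :=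
    (AddMonoidHom.toMultiplicativeRight (LinearMap.range i).mkQ.toAddMonoidHom).comp
      Abelianization.of
  have hB : B ≤ toCoker.ker := by
    intro b hb
    have hmem := LinearMap.mem_range_self i (e ⟨b, hb⟩).toAdd
    rw [hi_apply] at hmem
    exact congrArg Multiplicative.ofAdd ((Submodule.Quotient.mk_eq_zero _).mpr hmem)
  let p : Additive (Abelianization (G ⧸ B)) →ₗ[ℤ]
      Additive (Abelianization G) ⧸ LinearMap.range i :=
    (MonoidHom.toAdditiveLeft
      (Abelianization.lift (QuotientGroup.lift B toCoker hB))).toIntLinearMap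
  have hp : Function.Surjective p := by
    intro c
    obtain ⟨c, rfl⟩ := Submodule.mkQ_surjective _ c
    obtain ⟨c, rfl⟩ := Additive.ofMul.surjective c
    obtain ⟨c, rfl⟩ := QuotientGroup.mk_surjective c
    exact ⟨.ofMul (Abelianization.of (c : G ⧸ B)), rfl⟩
  have hi := i.injective_of_surjective_prod sM hsM p hp
  refine ⟨fun x y hxy ↦ ?_, ?_⟩
  · apply e.injective
    apply Multiplicative.toAdd.injective
    apply hi
    rw [hi_apply, hi_apply]
    exact congrArg Additive.ofMul hxy
  · obtain ⟨d, f, hd, hf⟩ := exists_linearMap_comp_eq_smul i hi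
    refine ⟨e.symm.toMonoidHom.comp ((AddMonoidHom.toMultiplicativeRight
      f.toAddMonoidHom).comp Abelianization.of), d, hd, fun b ↦ ?_⟩
    apply e.injective
    apply Multiplicative.toAdd.injective
    have := hf (e b).toAdd
    rw [hi_apply] at this
    simpa using this

open scoped IsMulCommutative in
/-- Averaging a homomorphism `f : N →* A` over `G ⧸ N` makes it `G`-equivariant. -/
theorem exists_equivariant_monoidHom {G : Type*} [Group G] (A N : Subgroup G) [A.Normal]
    [N.Normal] [N.FiniteIndex] [IsMulCommutative A] (hAN : A ≤ N)
    (hcentral : ∀ h ∈ N, ∀ a : A, MulAut.conjNormal h a = a)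
    (f : N →* A) (d : ℤ) (hf : ∀ a : A, f (Subgroup.inclusion hAN a) = a ^ d) :
    ∃ F : N →* A, (∀ (g : G) (n : N), F (MulAut.conjNormal g n) = MulAut.conjNormal g (F n)) ∧
      ∀ a : A, F (Subgroup.inclusion hAN a) = a ^ (d * N.index) := by
  let := Fintype.ofFinite (G ⧸ N)
  let T (g : G) : N →* A :=
    (MulAut.conjNormal g).toMonoidHom.comp (f.comp (MulAut.conjNormal g⁻¹).toMonoidHom)
  have T_apply (g : G) (n : N) :
      T g n = MulAut.conjNormal g (f (MulAut.conjNormal g⁻¹ n)) := rfl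
  have f_conj (h n : N) : f (MulAut.conjNormal (h : G) n) = f n := by
    have : MulAut.conjNormal (h : G) n = h * n * h⁻¹ := by ext; simp
    rw [this]
    simp
  have T_mul (g : G) (h : N) : T (g * h) = T g := by
    ext1 n
    rw [T_apply, T_apply, map_mul, MulAut.mul_apply, hcentral h h.2, mul_inv_rev, map_mul,
      MulAut.mul_apply, ← N.coe_inv, f_conj]
  have T_out (g : G) : T (g : G ⧸ N).out = T g := by
    obtain ⟨h, hh⟩ := QuotientGroup.mk_out_eq_mul N g
    rw [hh, T_mul]
  have T_conj (g x : G) (n : N) :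
      T (g * x) (MulAut.conjNormal g n) = MulAut.conjNormal g (T x n) := by
    simp [T_apply, map_mul, MulAut.mul_apply]
  refine ⟨∏ x : G ⧸ N, T x.out, fun g n ↦ ?_, fun a ↦ ?_⟩
  · rw [MonoidHom.finsetProd_apply, MonoidHom.finsetProd_apply, map_prod]
    symm
    refine Fintype.prod_equiv (MulAction.toPerm g) _ _ fun x ↦ ?_
    rw [← T_conj, ← T_out]
    congr 3
    conv_rhs => rw [MulAction.toPerm_apply, ← x.out_eq']
    rfl
  · have T_incl (g : G) : T g (Subgroup.inclusion hAN a) = a ^ d := by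
      have : MulAut.conjNormal g⁻¹ (Subgroup.inclusion hAN a) =
          Subgroup.inclusion hAN (MulAut.conjNormal g⁻¹ a) := by ext; simp
      rw [T_apply, this, hf, map_zpow]
      simp
    rw [MonoidHom.finsetProd_apply, Finset.prod_congr rfl fun x _ ↦ T_incl x.out]
    simp [zpow_mul, Subgroup.index, Nat.card_eq_fintype_card]

theorem Subgroup.finiteIndex_range_zpowGroupHom {A : Type*} [CommGroup A] [Group.FG A] {m : ℤ}
    (hm : m ≠ 0) : (zpowGroupHom m : A →* A).range.FiniteIndex := by
  have : Group.FG (A ⧸ (zpowGroupHom m : A →* A).range) := QuotientGroup.fg _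
  have torsion : IsMulTorsion (A ⧸ (zpowGroupHom m : A →* A).range) := by
    intro x
    obtain ⟨a, rfl⟩ := QuotientGroup.mk_surjective x
    refine isOfFinOrder_iff_zpow_eq_one.mpr ⟨m, hm, ?_⟩
    rw [← QuotientGroup.mk_zpow, QuotientGroup.eq_one_iff]
    exact ⟨a, rfl⟩
  have := CommGroup.finite_of_fg_isMulTorsion _ torsion
  exact Subgroup.finiteIndex_of_finite_quotient

open scoped IsMulCommutative in
/-- The kernel of an equivariant `F : N →* A` restricting to a nonzero power map on `A` is a normal
subgroup of `G` that is a complement of `A` up to finite index. -/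
theorem exists_normal_complement_of_equivariant {G : Type*} [Group G] (A N : Subgroup G) [A.Normal]
    [N.Normal] [N.FiniteIndex] [IsMulCommutative A] [Group.FG A] [IsMulTorsionFree A]
    (hAN : A ≤ N) (F : N →* A)
    (hF : ∀ (g : G) (n : N), F (MulAut.conjNormal g n) = MulAut.conjNormal g (F n))
    {m : ℤ} (hm : m ≠ 0) (hFA : ∀ a : A, F (Subgroup.inclusion hAN a) = a ^ m) :
    ∃ K : Subgroup G, K.Normal ∧ Disjoint A K ∧ (A ⊔ K).FiniteIndex := by
  refine ⟨F.ker.map N.subtype, ⟨?_⟩, ?_, ?_⟩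
  · rintro _ ⟨n, hn, rfl⟩ g
    refine ⟨MulAut.conjNormal g n, ?_, by simp⟩
    simp only [SetLike.mem_coe, MonoidHom.mem_ker] at hn ⊢
    rw [hF, hn, map_one]
  · rw [Subgroup.disjoint_def]
    rintro a ha ⟨n, hn, rfl⟩
    have := hFA ⟨n, ha⟩
    rw [show Subgroup.inclusion hAN ⟨n, ha⟩ = n from rfl, hn] at this
    have := zpow_left_injective hm (this.symm.trans (one_zpow m).symm)
    exact congrArg Subtype.val this
  · have := Subgroup.finiteIndex_range_zpowGroupHom (A := A) hm
    have le : ((zpowGroupHom m : A →* A).range.comap F).map N.subtype ≤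
        A ⊔ F.ker.map N.subtype := by
      rintro _ ⟨n, ⟨a, ha⟩, rfl⟩
      have : (Subgroup.inclusion hAN a)⁻¹ * n ∈ F.ker := by
        rw [MonoidHom.mem_ker, map_mul, map_inv, hFA, ← ha]
        simp
      have := Subgroup.mul_mem_sup a.2 (Subgroup.mem_map_of_mem N.subtype this)
      simpa using this
    have : (((zpowGroupHom m : A →* A).range.comap F).map N.subtype).FiniteIndex := by
      refine ⟨?_⟩
      rw [Subgroup.index_map_subtype, Subgroup.index_comap]
      exact mul_ne_zero (Subgroup.isFiniteRelIndex_of_finiteIndex).relIndex_ne_zero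
        Subgroup.FiniteIndex.index_ne_zero
    exact Subgroup.finiteIndex_of_le le

theorem lemma1_intermediate {π : Type*} [Group π] [Group.FG π] (r : ℕ)
    (A N : Subgroup π) [A.Normal] [N.Normal] (hAN : A ≤ N)
    (hA : Nonempty (A ≃* Multiplicative (Fin r → ℤ)))
    (hNindex : N.FiniteIndex)
    (hsplit : Nonempty (N ≃* (A.subgroupOf N) × (N ⧸ A.subgroupOf N))) :
    ∃ (H : Type) (_ : Group H) (q : π →* H),
      Function.Surjective q ∧
      Function.Injective (q.comp A.subtype) ∧
      (A.map q).FiniteIndex := by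
  obtain ⟨e⟩ := hA
  obtain ⟨s⟩ := hsplit
  have : Group.FG N := Subgroup.fg_of_index_ne_zero N
  have : IsMulCommutative A := ⟨⟨fun x y ↦ e.injective (by simp [mul_comm])⟩⟩
  have : IsMulTorsionFree A := Function.Injective.isMulTorsionFree e.toMonoidHom e.injective
  have : Group.FG A := Group.fg_of_surjective (f := e.symm.toMonoidHom) e.symm.surjective
  let j : A.subgroupOf N ≃* A := Subgroup.subgroupOfEquivOfLe hAN
  obtain ⟨hinj, f, d, hd, hf⟩ :=
    exists_monoidHom_eq_zpow_of_mulEquiv_prod (A.subgroupOf N) (j.trans e) s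
  have hcentral (h : π) (hh : h ∈ N) (a : A) : MulAut.conjNormal h a = a := by
    apply j.symm.injective
    apply hinj
    have : ((j.symm (MulAut.conjNormal h a) : A.subgroupOf N) : N) =
        ⟨h, hh⟩ * (j.symm a : A.subgroupOf N) * ⟨h, hh⟩⁻¹ := by
      ext; simp [j]
    simp [this]
  obtain ⟨F, hF, hFA⟩ := exists_equivariant_monoidHom A N hAN hcentral (j.toMonoidHom.comp f) d
    fun a ↦ by
      have := congrArg j (hf (j.symm a))
      rw [map_zpow, j.apply_symm_apply] at this
      exact this
  obtain ⟨K, hK, hdisj, hfin⟩ := exists_normal_complement_of_equivariant A N hAN F hF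
    (mul_ne_zero hd (Int.natCast_ne_zero.mpr hNindex.index_ne_zero)) hFA
  have : Countable π := Group.FG.countable π
  have : Countable (π ⧸ K) := (QuotientGroup.mk'_surjective K).countable
  have : Small.{0} (π ⧸ K) := Countable.toSmall _
  let c : π ⧸ K ≃* Shrink.{0} (π ⧸ K) := Shrink.mulEquiv.symm
  let q : π →* Shrink.{0} (π ⧸ K) := c.toMonoidHom.comp (QuotientGroup.mk' K)
  have hq : Function.Surjective q := c.surjective.comp (QuotientGroup.mk'_surjective K)
  have hker : q.ker = K := by
    ext x
    simp [q]
  refine ⟨Shrink.{0} (π ⧸ K), inferInstance, q, hq, ?_, ⟨?_⟩⟩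
  · rw [injective_iff_map_eq_one]
    intro a ha
    have : (a : π) ∈ K := hker ▸ ha
    exact Subtype.ext (Subgroup.disjoint_def.mp hdisj a.2 this)
  · rw [Subgroup.index_map, hker, q.range_eq_top.mpr hq, Subgroup.index_top, mul_one]
    exact hfin.index_ne_zero
end

section
/- Let G be a finite group and let M be an abelian group, finitely generated as an abelian group, equipped with an action of G by group automorphisms (i.e., M is a finitely generated ℤ[G]-module). Let A ≤ M be a G-invariant subgroup which is free abelian of rank r and is a direct summand of M as an abelian group. Then there exists a G-invariant subgroup K ≤ M such that A ∩ K = 0, the quotient M/K is free abelian of rank r, and the image of A in M/K has finite index. -/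
/-- Averaging a projection over a finite group: if the `G`-invariant subgroup `A` is a direct summand,
there is a `G`-equivariant homomorphism `M →+ A` whose restriction to `A` is multiplication by the
order of `G`. -/
theorem exists_equivariant_hom_apply_eq_card_nsmul {G : Type*} [Group G] [Finite G]
    {M : Type*} [AddCommGroup M] [DistribMulAction G M] {A B : AddSubgroup M}
    (hGA : ∀ (g : G) (a : M), a ∈ A → g • a ∈ A) (hAB : IsCompl A B) :
    ∃ f : M →+ A, (∀ (g : G) (x : M), (f (g • x) : M) = g • (f x : M)) ∧
      ∀ a : A, f a = Nat.card G • a := by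
  cases nonempty_fintype G
  have hAB' : IsCompl (AddSubgroup.toIntSubmodule A) (AddSubgroup.toIntSubmodule B) :=
    AddSubgroup.toIntSubmodule.isCompl hAB
  let p : M →+ M := ((AddSubgroup.toIntSubmodule A).projection _ hAB').toAddMonoidHom
  have p_mem (x : M) : p x ∈ A := Submodule.projection_apply_mem hAB' x
  have p_of_mem {x : M} (hx : x ∈ A) : p x = x :=
    Submodule.projection_apply_of_mem_left hAB' hx
  let q : M →+ M := ∑ g : G, (DistribSMul.toAddMonoidHom M g).comp
    (p.comp (DistribSMul.toAddMonoidHom M g⁻¹))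
  have q_apply (x : M) : q x = ∑ g : G, g • p (g⁻¹ • x) := by
    simp [q, AddMonoidHom.finsetSum_apply]
  have q_mem (x : M) : q x ∈ A := by
    rw [q_apply]
    exact sum_mem fun g _ ↦ hGA g _ (p_mem _)
  refine ⟨q.codRestrict A q_mem, fun h x ↦ ?_, fun a ↦ Subtype.ext ?_⟩
  · simp only [AddMonoidHom.codRestrict_apply, q_apply, Finset.smul_sum]
    refine (Fintype.sum_equiv (Equiv.mulLeft h) _ _ fun g ↦ ?_).symm
    simp [mul_smul]
  · simp only [AddMonoidHom.codRestrict_apply, q_apply, AddSubgroup.coe_nsmul]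
    rw [Finset.sum_congr rfl fun g _ ↦ by rw [p_of_mem (hGA g⁻¹ a a.2), smul_inv_smul]]
    simp

/-- An abelian group that embeds into `ℤ^r` and into which `ℤ^r` embeds is isomorphic to `ℤ^r`. -/
theorem nonempty_addEquiv_pi_int_of_injective {N : Type*} [AddCommGroup N] {r : ℕ}
    {f : N →+ (Fin r → ℤ)} (hf : Function.Injective f)
    {g : (Fin r → ℤ) →+ N} (hg : Function.Injective g) :
    Nonempty (N ≃+ (Fin r → ℤ)) := by
  let e := LinearEquiv.ofInjective f.toIntLinearMap hf
  have : Module.Free ℤ N := .of_equiv e.symm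
  have : Module.Finite ℤ N := .equiv e.symm
  have hle := LinearMap.finrank_le_finrank_of_injective (f := f.toIntLinearMap) hf
  have hge := LinearMap.finrank_le_finrank_of_injective (f := g.toIntLinearMap) hg
  exact ⟨(LinearEquiv.ofFinrankEq N (Fin r → ℤ) (hle.antisymm hge)).toAddEquiv⟩

/-- A subgroup of a finitely generated abelian group that contains a nonzero multiple of every
element has finite index. -/
theorem AddSubgroup.finiteIndex_of_nsmul_mem {N : Type*} [AddCommGroup N] [AddGroup.FG N]
    {H : AddSubgroup N} {n : ℕ} (hn : 0 < n) (h : ∀ x : N, n • x ∈ H) : H.FiniteIndex := by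
  have : Finite (N ⧸ H) := by
    refine AddCommGroup.finite_of_fg_isAddTorsion _ fun x ↦ ?_
    induction x using QuotientAddGroup.induction_on with
    | H x =>
      rw [isOfFinAddOrder_iff_nsmul_eq_zero]
      exact ⟨n, hn, by rw [← QuotientAddGroup.mk_nsmul, QuotientAddGroup.eq_zero_iff]; exact h x⟩
  exact H.finiteIndex_of_finite_quotient

theorem module_step {G : Type*} [Group G] [Finite G]
    {M : Type*} [AddCommGroup M] [AddGroup.FG M]
    [DistribMulAction G M] (r : ℕ)
    (A : AddSubgroup M)
    (hGA : ∀ (g : G) (a : M), a ∈ A → g • a ∈ A)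
    (hA : Nonempty (A ≃+ (Fin r → ℤ)))
    (hsummand : ∃ B : AddSubgroup M, IsCompl A B) :
    ∃ K : AddSubgroup M,
      (∀ (g : G) (x : M), x ∈ K → g • x ∈ K) ∧
      A ⊓ K = ⊥ ∧
      Nonempty ((M ⧸ K) ≃+ (Fin r → ℤ)) ∧
      (A.map (QuotientAddGroup.mk' K)).FiniteIndex := by
  obtain ⟨e⟩ := hA
  obtain ⟨B, hAB⟩ := hsummand
  obtain ⟨f, f_smul, f_coe⟩ := exists_equivariant_hom_apply_eq_card_nsmul hGA hAB
  have hcard : Nat.card G ≠ 0 := Nat.card_pos.ne'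
  have : IsAddTorsionFree A := e.injective.isAddTorsionFree e.toAddMonoidHom
  have eq_zero (a : A) (ha : (a : M) ∈ f.ker) : a = 0 := by
    rw [AddMonoidHom.mem_ker, f_coe] at ha
    exact (nsmul_eq_zero_iff_right hcard).1 ha
  refine ⟨f.ker, fun g x hx ↦ ?_, ?_, ?_, ?_⟩
  · rw [AddMonoidHom.mem_ker] at hx ⊢
    exact Subtype.ext (by simp [f_smul, hx])
  · rw [eq_bot_iff]
    rintro x ⟨hxA, hxK⟩
    exact congrArg Subtype.val (eq_zero ⟨x, hxA⟩ hxK)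
  · refine nonempty_addEquiv_pi_int_of_injective
      (f := e.toAddMonoidHom.comp (QuotientAddGroup.kerLift f))
      (g := ((QuotientAddGroup.mk' f.ker).comp A.subtype).comp e.symm.toAddMonoidHom)
      (e.injective.comp (QuotientAddGroup.kerLift_injective f)) ?_
    refine Function.Injective.comp (g := (QuotientAddGroup.mk' f.ker).comp A.subtype) ?_
      e.symm.injective
    rw [injective_iff_map_eq_zero]
    exact fun a ha ↦ eq_zero a ((QuotientAddGroup.eq_zero_iff _).1 ha)
  · refine AddSubgroup.finiteIndex_of_nsmul_mem (Nat.pos_of_ne_zero hcard) fun x ↦ ?_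
    induction x using QuotientAddGroup.induction_on with
    | H x =>
      refine ⟨f x, (f x).2, ?_⟩
      rw [QuotientAddGroup.mk'_apply, ← QuotientAddGroup.mk_nsmul, QuotientAddGroup.eq,
        AddMonoidHom.mem_ker, map_add, map_neg, map_nsmul, f_coe, neg_add_cancel]
end

section
/- Let π be a group with an infinite cyclic normal subgroup A, let p : π → π/A be the quotient homomorphism, and suppose F is a free subgroup of finite index in π/A. Set N = p⁻¹(F) ∩ C_π(A), where C_π(A) is the centralizer of A in π. Then N has finite index in π, A is contained in N and is central in N, and N is isomorphic to the direct product A × (N/A). -/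
/-- A cyclic group, finite or infinite, has only finitely many automorphisms. -/
theorem IsCyclic.finite_mulAut (G : Type*) [Group G] [IsCyclic G] : Finite (MulAut G) := by
  have : Finite (ZMod (Nat.card G))ˣ := by
    rcases Nat.eq_zero_or_pos (Nat.card G) with h | h
    · rw [h]
      exact inferInstanceAs (Finite ℤˣ)
    · have : NeZero (Nat.card G) := ⟨h.ne'⟩
      infer_instance
  exact Finite.of_equiv _ (IsCyclic.mulAutMulEquiv G).symm.toEquiv

/-- The kernel of the conjugation action on a normal subgroup is its centralizer. -/
theorem MulAut.ker_conjNormal {G : Type*} [Group G] (A : Subgroup G) [A.Normal] :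
    (MulAut.conjNormal (H := A)).ker = Subgroup.centralizer (A : Set G) := by
  ext g
  simp only [MonoidHom.mem_ker, MulEquiv.ext_iff, Subtype.forall, Subtype.ext_iff,
    MulAut.conjNormal_apply, MulAut.one_apply, Subgroup.mem_centralizer_iff, SetLike.mem_coe,
    mul_inv_eq_iff_eq_mul]
  exact forall₂_congr fun _ _ ↦ eq_comm

/-- The centralizer of a cyclic normal subgroup has finite index. -/
theorem Subgroup.finiteIndex_centralizer_of_isCyclic {G : Type*} [Group G] (A : Subgroup G)
    [A.Normal] [IsCyclic A] : (Subgroup.centralizer (A : Set G)).FiniteIndex := by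
  have := IsCyclic.finite_mulAut A
  rw [← MulAut.ker_conjNormal]
  exact Subgroup.finiteIndex_ker _

/-- A homomorphism onto a free group has a section. -/
theorem IsFreeGroup.exists_section {G H : Type*} [Group G] [Group H] [IsFreeGroup H]
    (f : G →* H) (hf : Function.Surjective f) : ∃ s : H →* G, f.comp s = MonoidHom.id H := by
  refine ⟨IsFreeGroup.lift fun a ↦ Function.surjInv hf (IsFreeGroup.of a),
    IsFreeGroup.ext_hom fun a ↦ ?_⟩
  simp [Function.surjInv_eq]

/-- A central extension with free quotient splits as a direct product. -/
theorem Subgroup.nonempty_mulEquiv_prod_quotient {G : Type*} [Group G] (K : Subgroup G) [K.Normal]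
    (hK : K ≤ Subgroup.center G) [IsFreeGroup (G ⧸ K)] : Nonempty (G ≃* K × (G ⧸ K)) := by
  obtain ⟨s, hs⟩ := IsFreeGroup.exists_section _ (QuotientGroup.mk'_surjective K)
  replace hs (q : G ⧸ K) : (s q : G ⧸ K) = q := DFunLike.congr_fun hs q
  let φ : K × (G ⧸ K) →* G := K.subtype.noncommCoprod s fun k q ↦
    (Subgroup.mem_center_iff.mp (hK k.2) (s q)).symm
  have hφ (k : K) (q : G ⧸ K) : φ (k, q) = k * s q := rfl
  have hq (k : K) (q : G ⧸ K) : (φ (k, q) : G ⧸ K) = q := by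
    rw [hφ, QuotientGroup.mk_mul, hs, (QuotientGroup.eq_one_iff _).mpr k.2, one_mul]
  refine ⟨(MulEquiv.ofBijective φ ⟨?_, fun g ↦ ?_⟩).symm⟩
  · rintro ⟨k, q⟩ ⟨k', q'⟩ h
    obtain rfl : q = q' := by rw [← hq k q, h, hq]
    simpa [hφ] using h
  · refine ⟨(⟨g * (s g)⁻¹, ?_⟩, g), by simp [hφ]⟩
    rw [← QuotientGroup.eq_one_iff, QuotientGroup.mk_mul, QuotientGroup.mk_inv, hs,
      mul_inv_cancel]

/-- If the image of `N` in `G ⧸ A` lies in a free subgroup, then the quotient of `N` by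
its intersection with `A` is free. -/
theorem Subgroup.isFreeGroup_quotient_subgroupOf {G : Type*} [Group G] (A : Subgroup G) [A.Normal]
    (F : Subgroup (G ⧸ A)) [IsFreeGroup F] (N : Subgroup G)
    (hN : N ≤ F.comap (QuotientGroup.mk' A)) : IsFreeGroup (N ⧸ A.subgroupOf N) := by
  let f : N →* F := ((QuotientGroup.mk' A).comp N.subtype).codRestrict F fun n ↦ hN n.2
  have hf : f.ker = A.subgroupOf N := by
    ext n
    rw [MonoidHom.mem_ker, Subgroup.mem_subgroupOf, ← QuotientGroup.eq_one_iff]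
    exact Subtype.ext_iff
  exact IsFreeGroup.ofMulEquiv
    ((QuotientGroup.quotientMulEquivOfEq hf.symm).trans
      (QuotientGroup.quotientKerEquivRange f)).symm

theorem theorem2_construction {π : Type*} [Group π]
    (A : Subgroup π) [A.Normal]
    (hA : Nonempty (A ≃* Multiplicative ℤ))
    (F : Subgroup (π ⧸ A))
    (hFfree : ∃ (S : Type), Nonempty (F ≃* FreeGroup S))
    (hFfin : F.FiniteIndex) :
    (F.comap (QuotientGroup.mk' A) ⊓ Subgroup.centralizer (A : Set π)).FiniteIndex ∧
    A ≤ F.comap (QuotientGroup.mk' A) ⊓ Subgroup.centralizer (A : Set π) ∧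
    A.subgroupOf (F.comap (QuotientGroup.mk' A) ⊓ Subgroup.centralizer (A : Set π)) ≤
      Subgroup.center ↥(F.comap (QuotientGroup.mk' A) ⊓ Subgroup.centralizer (A : Set π)) ∧
    Nonempty (↥(F.comap (QuotientGroup.mk' A) ⊓ Subgroup.centralizer (A : Set π)) ≃*
      ↥(A.subgroupOf (F.comap (QuotientGroup.mk' A) ⊓ Subgroup.centralizer (A : Set π))) ×
      (↥(F.comap (QuotientGroup.mk' A) ⊓ Subgroup.centralizer (A : Set π)) ⧸
        A.subgroupOf (F.comap (QuotientGroup.mk' A) ⊓ Subgroup.centralizer (A : Set π)))) := by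
  obtain ⟨a⟩ := hA
  obtain ⟨S, ⟨e⟩⟩ := hFfree
  have : IsFreeGroup F := IsFreeGroup.ofMulEquiv e.symm
  have : IsCyclic A := isCyclic_of_surjective a.symm a.symm.surjective
  have := A.finiteIndex_centralizer_of_isCyclic
  have : (F.comap (QuotientGroup.mk' A)).FiniteIndex :=
    ⟨by
      rw [Subgroup.index_comap_of_surjective _ (QuotientGroup.mk'_surjective A)]
      exact hFfin.index_ne_zero⟩
  have hcentral : A.subgroupOf (F.comap (QuotientGroup.mk' A) ⊓ Subgroup.centralizer (A : Set π)) ≤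
      Subgroup.center ↥(F.comap (QuotientGroup.mk' A) ⊓ Subgroup.centralizer (A : Set π)) :=
    fun x hx ↦ Subgroup.mem_center_iff.mpr fun g ↦
      Subtype.ext (Subgroup.mem_centralizer_iff.mp g.2.2 x hx).symm
  have := A.isFreeGroup_quotient_subgroupOf F
    (F.comap (QuotientGroup.mk' A) ⊓ Subgroup.centralizer (A : Set π)) inf_le_left
  refine ⟨inferInstance, le_inf (fun x hx ↦ ?_) ?_, hcentral,
    Subgroup.nonempty_mulEquiv_prod_quotient _ hcentral⟩
  · rw [Subgroup.mem_comap, QuotientGroup.mk'_apply, (QuotientGroup.eq_one_iff x).mpr hx]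
    exact F.one_mem
  · have : IsMulCommutative A := inferInstance
    exact A.le_centralizer
end

section
/- Let H be a group containing a free abelian subgroup of rank r of finite index. Then H has a maximal finite normal subgroup: there exists a finite normal subgroup T of H such that every finite normal subgroup of H is contained in T. -/
/-- A finite subgroup is no larger than the index of a torsion-free subgroup of finite index. -/
theorem Subgroup.card_le_index_of_isMulTorsionFree {H : Type*} [Group H] (A S : Subgroup H)
    [IsMulTorsionFree A] [A.FiniteIndex] [Finite S] : Nat.card S ≤ A.index := by
  have hdisj : A ⊓ S = ⊥ := by
    rw [eq_bot_iff]
    rintro x ⟨hxA, hxS⟩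
    have hfin : IsOfFinOrder (⟨x, hxA⟩ : A) := by
      apply (Submonoid.isOfFinOrder_coe (H := A.toSubmonoid)).1
      exact (Submonoid.isOfFinOrder_coe (H := S.toSubmonoid)).2
        (isOfFinOrder_of_finite (⟨x, hxS⟩ : S))
    simpa using hfin.eq_one'
  rw [← Subgroup.relIndex_bot_left, ← hdisj, Subgroup.inf_relIndex_right,
    ← Subgroup.relIndex_top_right]
  exact Subgroup.relIndex_le_of_le_right le_top (by simpa using A.index_ne_zero_of_finite)

/-- If the finite normal subgroups of a group have bounded order, one of them contains all the
others. -/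
theorem Subgroup.exists_greatest_finite_normal_of_card_le {H : Type*} [Group H] (n : ℕ)
    (hn : ∀ S : Subgroup H, S.Normal → (S : Set H).Finite → Nat.card S ≤ n) :
    ∃ T : Subgroup H, T.Normal ∧ (T : Set H).Finite ∧
      ∀ S : Subgroup H, S.Normal → (S : Set H).Finite → S ≤ T := by
  let P : Set (Subgroup H) := {S | S.Normal ∧ (S : Set H).Finite}
  have hbdd : ((fun S : Subgroup H ↦ Nat.card S) '' P).Finite :=
    (Set.finite_Iic n).subset (by rintro _ ⟨S, hS, rfl⟩; exact hn S hS.1 hS.2)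
  obtain ⟨T, ⟨hTn, hTf⟩, hmax⟩ := Set.Finite.exists_maximalFor' _ P hbdd
    ⟨⊥, inferInstance, by simp⟩
  refine ⟨T, hTn, hTf, fun S hSn hSf ↦ ?_⟩
  have hfin : ((S ⊔ T : Subgroup H) : Set H).Finite := by
    rw [Subgroup.mul_normal]
    exact hSf.mul hTf
  have : Finite (S ⊔ T : Subgroup H) := hfin
  have hle : Nat.card (S ⊔ T : Subgroup H) ≤ Nat.card T :=
    hmax ⟨Subgroup.sup_normal S T, hfin⟩ (Subgroup.card_le_of_le le_sup_right)
  exact le_sup_left.trans (Subgroup.eq_of_le_of_card_ge le_sup_right hle).ge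

theorem maximal_finite_normal_subgroup {H : Type*} [Group H] (r : ℕ)
    (A : Subgroup H)
    (hA : Nonempty (A ≃* Multiplicative (Fin r → ℤ)))
    (hAfin : A.FiniteIndex) :
    ∃ T : Subgroup H, T.Normal ∧ (T : Set H).Finite ∧
      ∀ S : Subgroup H, S.Normal → (S : Set H).Finite → S ≤ T := by
  obtain ⟨e⟩ := hA
  have : IsMulTorsionFree A := e.injective.isMulTorsionFree e.toMonoidHom
  refine Subgroup.exists_greatest_finite_normal_of_card_le A.index fun S _ hS ↦ ?_
  have : Finite S := hS
  exact A.card_le_index_of_isMulTorsionFree S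
end
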